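/- arXiv:1905.06223 — 2 statements merged into one kernel-verified Lean document; each statement's English description precedes it below -/
import Mathlib

section
/- Let k, n, m, d be positive integers with 2n + k = d − m, and set l = min(k, m). Then S_d(n, n+k, n+k) ⊆ co{ ((d−1)/d)·S_{d−1}(n, n+k, n+k), ((d−2l)/d)·S_{d−2l}(n, n+k−l, n+k−l) }. -/
open Matrix
open scoped Pointwise ComplexOrder

/-- `P` is an orthogonal projection matrix: `P = P† = P²`. -/
def IsProjn {d : ℕ} (P : Matrix (Fin d) (Fin d) ℂ) : Prop :=
  P.IsHermitian ∧ P * P = P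

/-- `corrSet d n₁ n₂ n₃` is the set `S_d(n₁,n₂,n₃) ⊆ ℝ³` of triples of normalized
traces of pairwise products of orthogonal projections of the prescribed ranks. -/
def corrSet (d n₁ n₂ n₃ : ℕ) : Set (ℝ × ℝ × ℝ) :=
  { x | ∃ P₁ P₂ P₃ : Matrix (Fin d) (Fin d) ℂ,
      IsProjn P₁ ∧ IsProjn P₂ ∧ IsProjn P₃ ∧
      P₁.rank = n₁ ∧ P₂.rank = n₂ ∧ P₃.rank = n₃ ∧
      x = ((1 / (d : ℝ)) * ((P₁ * P₂).trace).re,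
           (1 / (d : ℝ)) * ((P₁ * P₃).trace).re,
           (1 / (d : ℝ)) * ((P₂ * P₃).trace).re) }

theorem IsProjn.trace_eq_rank {d : ℕ} {P : Matrix (Fin d) (Fin d) ℂ} (hP : IsProjn P) :
    P.trace = P.rank := by
  have h : LinearMap.IsProj (LinearMap.range P.mulVecLin) P.mulVecLin := by
    refine ⟨fun x => ⟨x, rfl⟩, ?_⟩
    rintro _ ⟨y, rfl⟩
    simp [hP.2]
  have ht := h.trace
  rw [Matrix.rank, ← ht, ← Matrix.toLin'_apply', Matrix.trace_toLin'_eq]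

theorem IsProjn.conj {d : ℕ} {P U : Matrix (Fin d) (Fin d) ℂ} (hP : IsProjn P)
    (hU : Uᴴ * U = 1) : IsProjn (U * P * Uᴴ) := by
  refine ⟨?_, ?_⟩
  · rw [Matrix.IsHermitian, conjTranspose_mul, conjTranspose_mul, conjTranspose_conjTranspose,
      hP.1.eq, Matrix.mul_assoc]
  · calc U * P * Uᴴ * (U * P * Uᴴ) = U * P * (Uᴴ * U) * P * Uᴴ := by
          simp only [Matrix.mul_assoc]
      _ = U * (P * P) * Uᴴ := by rw [hU, Matrix.mul_one, Matrix.mul_assoc U P P]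
      _ = U * P * Uᴴ := by rw [hP.2]

theorem isCompact_convexHull_of_isCompact {E : Type*} [AddCommGroup E] [Module ℝ E]
    [TopologicalSpace E] [ContinuousAdd E] [ContinuousSMul ℝ E] [FiniteDimensional ℝ E]
    {s : Set E} (hs : IsCompact s) : IsCompact (convexHull ℝ s) := by
  rcases s.eq_empty_or_nonempty with rfl | ⟨p, hp⟩
  · simp
  set N := Module.finrank ℝ E + 1
  have hK : IsCompact (stdSimplex ℝ (Fin N) ×ˢ Set.univ.pi fun _ : Fin N => s) :=
    (isCompact_stdSimplex ℝ (Fin N)).prod (isCompact_univ_pi fun _ => hs)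
  have hcont : Continuous fun q : (Fin N → ℝ) × (Fin N → E) => ∑ i, q.1 i • q.2 i := by fun_prop
  convert hK.image hcont
  ext x
  constructor
  · intro hx
    obtain ⟨ι, _, z, w, hz, hi, hw, hw1, rfl⟩ := eq_pos_convex_span_of_mem_convexHull hx
    have hcard : Fintype.card ι ≤ Fintype.card (Fin N) := by
      have h := hi.card_le_finrank_succ
      have h' := Submodule.finrank_le (vectorSpan ℝ (Set.range z))
      rw [Fintype.card_fin]
      omega
    obtain ⟨e⟩ := Function.Embedding.nonempty_of_card_le hcard
    refine ⟨(Function.extend e w 0, Function.extend e z fun _ => p), ⟨⟨fun i => ?_, ?_⟩, ?_⟩, ?_⟩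
    · by_cases h : ∃ a, e a = i
      · obtain ⟨a, rfl⟩ := h
        dsimp only
        rw [e.injective.extend_apply]
        exact (hw a).le
      · simp [Function.extend_apply' _ _ _ h]
    · rw [← hw1]
      refine (Fintype.sum_of_injective e e.injective _ _ (fun i hi => ?_) fun a => ?_).symm
      · exact Function.extend_apply' _ _ _ hi
      · exact (e.injective.extend_apply _ _ _).symm
    · intro i _
      by_cases h : ∃ a, e a = i
      · obtain ⟨a, rfl⟩ := h
        dsimp only
        rw [e.injective.extend_apply]
        exact hz ⟨a, rfl⟩
      · simpa [Function.extend_apply' _ _ _ h] using hp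
    · refine (Fintype.sum_of_injective e e.injective _ _ (fun i hi => ?_) fun a => ?_).symm
      · simp [Function.extend_apply' _ _ _ hi]
      · simp [e.injective.extend_apply]
  · rintro ⟨⟨w, z⟩, ⟨⟨hw, hw1⟩, hz⟩, rfl⟩
    exact mem_convexHull_of_exists_fintype w z hw hw1 (fun i => hz i trivial) rfl

theorem IsProjn.norm_apply_le_one {d : ℕ} {P : Matrix (Fin d) (Fin d) ℂ} (hP : IsProjn P)
    (i j : Fin d) : ‖P i j‖ ≤ 1 := by
  have hsum : (P i i).re = ∑ k, ‖P i k‖ ^ 2 := by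
    have h := congrFun (congrFun hP.2 i) i
    rw [Matrix.mul_apply] at h
    rw [← h, Complex.re_sum]
    refine Finset.sum_congr rfl fun k _ => ?_
    rw [← hP.1.apply k i, Complex.star_def, Complex.mul_conj, Complex.ofReal_re,
      Complex.normSq_eq_norm_sq]
  have hle (k) : ‖P i k‖ ^ 2 ≤ (P i i).re := by
    rw [hsum]
    exact Finset.single_le_sum (f := fun k => ‖P i k‖ ^ 2) (fun _ _ => sq_nonneg _)
      (Finset.mem_univ k)
  have hre : (P i i).re ≤ ‖P i i‖ := Complex.re_le_norm _
  have hii : ‖P i i‖ ≤ 1 := by nlinarith [hle i, norm_nonneg (P i i)]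
  nlinarith [hle j, norm_nonneg (P i j)]

theorem isCompact_setOf_isProjn_rank (d r : ℕ) :
    IsCompact {P : Matrix (Fin d) (Fin d) ℂ | IsProjn P ∧ P.rank = r} := by
  have hK : IsCompact (Set.univ.pi fun _ : Fin d => Set.univ.pi fun _ : Fin d =>
      Metric.closedBall (0 : ℂ) 1) :=
    isCompact_univ_pi fun _ => isCompact_univ_pi fun _ => isCompact_closedBall _ _
  have hset : {P : Matrix (Fin d) (Fin d) ℂ | IsProjn P ∧ P.rank = r} =
      {P | Pᴴ = P} ∩ {P | P * P = P} ∩ {P | P.trace = (r : ℂ)} := by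
    ext P
    constructor
    · rintro ⟨h, rfl⟩
      exact ⟨h, h.trace_eq_rank⟩
    · rintro ⟨h, ht⟩
      refine ⟨h, ?_⟩
      have hh := IsProjn.trace_eq_rank (P := P) h
      rw [Set.mem_ofPred_eq.mp ht] at hh
      exact_mod_cast hh.symm
  refine hK.of_isClosed_subset ?_ ?_
  · rw [hset]
    refine ((isClosed_eq ?_ ?_).inter (isClosed_eq ?_ ?_)).inter (isClosed_eq ?_ ?_) <;> fun_prop
  · intro P hP i _ j _
    exact mem_closedBall_zero_iff.mpr (hP.1.norm_apply_le_one i j)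

theorem isCompact_corrSet (d n₁ n₂ n₃ : ℕ) : IsCompact (corrSet d n₁ n₂ n₃) := by
  have hK := (isCompact_setOf_isProjn_rank d n₁).prod
    ((isCompact_setOf_isProjn_rank d n₂).prod (isCompact_setOf_isProjn_rank d n₃))
  have hcont : Continuous fun P : Matrix (Fin d) (Fin d) ℂ × Matrix (Fin d) (Fin d) ℂ ×
      Matrix (Fin d) (Fin d) ℂ => ((1 / (d : ℝ)) * ((P.1 * P.2.1).trace).re,
        (1 / (d : ℝ)) * ((P.1 * P.2.2).trace).re,
        (1 / (d : ℝ)) * ((P.2.1 * P.2.2).trace).re) := by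
    have hre := Complex.continuous_re
    fun_prop
  convert hK.image hcont
  ext x
  constructor
  · rintro ⟨P₁, P₂, P₃, h₁, h₂, h₃, r₁, r₂, r₃, rfl⟩
    exact ⟨(P₁, P₂, P₃), ⟨⟨h₁, r₁⟩, ⟨h₂, r₂⟩, ⟨h₃, r₃⟩⟩, rfl⟩
  · rintro ⟨⟨P₁, P₂, P₃⟩, ⟨⟨h₁, r₁⟩, ⟨h₂, r₂⟩, ⟨h₃, r₃⟩⟩, rfl⟩
    exact ⟨P₁, P₂, P₃, h₁, h₂, h₃, r₁, r₂, r₃, rfl⟩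

theorem eq_zero_of_re_trace_conjTranspose_mul_self {m n : Type*} [Fintype m] [Fintype n]
    {A : Matrix m n ℂ} (h : (Aᴴ * A).trace.re = 0) : A = 0 := by
  have h0 := (posSemidef_conjTranspose_mul_self A).trace_nonneg
  rw [Complex.le_def] at h0
  exact trace_conjTranspose_mul_self_eq_zero_iff.mp (Complex.ext h h0.2.symm)

open NormedSpace in
open scoped Matrix.Norms.Operator in
theorem hasDerivAt_re_trace_exp_conj {d : ℕ} (P H K : Matrix (Fin d) (Fin d) ℂ) :
    HasDerivAt (fun t : ℝ => ((exp (t • K) * P * exp (t • -K) * H).trace).re)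
      (((K * P - P * K) * H).trace).re 0 := by
  have h1 : HasDerivAt (fun t : ℝ => exp (t • K)) K 0 := by
    have h := hasDerivAt_exp_smul_const (𝕂 := ℝ) K 0
    rw [zero_smul, exp_zero, one_mul] at h
    exact h
  have h2 : HasDerivAt (fun t : ℝ => exp (t • -K)) (-K) 0 := by
    have h := hasDerivAt_exp_smul_const (𝕂 := ℝ) (-K) 0
    rw [zero_smul, exp_zero, one_mul] at h
    exact h
  have h3 := (((h1.mul_const P).mul h2).mul_const H)
  let L : Matrix (Fin d) (Fin d) ℂ →ₗ[ℝ] ℝ :=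
    Complex.reLm ∘ₗ (traceLinearMap (Fin d) ℝ ℂ)
  have h4 := (L.toContinuousLinearMap.hasFDerivAt).comp_hasDerivAt (0 : ℝ) h3
  refine HasDerivAt.congr_deriv h4 ?_
  simp [L, sub_eq_add_neg]
  rfl

/-- First-order optimality of a projection in its unitary orbit. -/
theorem IsProjn.commute_of_forall_le {d : ℕ} {P H : Matrix (Fin d) (Fin d) ℂ} (hP : IsProjn P)
    (hH : H.IsHermitian)
    (hmax : ∀ Q : Matrix (Fin d) (Fin d) ℂ, IsProjn Q → Q.rank = P.rank →
      ((Q * H).trace).re ≤ ((P * H).trace).re) : P * H = H * P := by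
  obtain ⟨K, hK⟩ : ∃ K, K = P * H - H * P := ⟨_, rfl⟩
  have hKs : Kᴴ = -K := by
    rw [hK, conjTranspose_sub, conjTranspose_mul, conjTranspose_mul, hP.1.eq, hH.eq, neg_sub]
  have hloc : IsLocalMax (fun t : ℝ => ((NormedSpace.exp (t • K) * P *
      NormedSpace.exp (t • -K) * H).trace).re) 0 := by
    refine Filter.Eventually.of_forall fun t => ?_
    have hstar : NormedSpace.exp (t • -K) = (NormedSpace.exp (t • K))ᴴ := by
      rw [← Matrix.exp_conjTranspose, conjTranspose_smul, hKs, star_trivial]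
    have hinv : NormedSpace.exp (t • -K) * NormedSpace.exp (t • K) = 1 := by
      rw [← Matrix.exp_add_of_commute _ _ (by simp)]
      simp
    have hinv' := mul_eq_one_comm.mp hinv
    have hc : IsProjn (NormedSpace.exp (t • K) * P * NormedSpace.exp (t • -K)) := by
      rw [hstar] at hinv ⊢
      exact hP.conj hinv
    have hr : (NormedSpace.exp (t • K) * P * NormedSpace.exp (t • -K)).rank = P.rank := by
      have h := hc.trace_eq_rank
      rw [trace_mul_comm, ← Matrix.mul_assoc, hinv, Matrix.one_mul, hP.trace_eq_rank] at h
      exact_mod_cast h.symm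
    simpa using hmax _ hc hr
  have h0 := hloc.hasDerivAt_eq_zero (hasDerivAt_re_trace_exp_conj P H K)
  have ht : ((K * P - P * K) * H).trace = -(Kᴴ * K).trace := by
    rw [hKs, Matrix.sub_mul, trace_sub, Matrix.neg_mul, trace_neg, neg_neg]
    have hKK : (K * K).trace = (K * (P * H - H * P)).trace := by rw [← hK]
    rw [hKK, Matrix.mul_sub, trace_sub, Matrix.mul_assoc, Matrix.trace_mul_cycle P K H,
      trace_mul_comm (H * P) K]
  rw [ht, Complex.neg_re, neg_eq_zero] at h0
  exact sub_eq_zero.mp (hK ▸ eq_zero_of_re_trace_conjTranspose_mul_self h0)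

theorem exists_isometry_mul_eq_zero {d l : ℕ} (A B : Matrix (Fin d) (Fin d) ℂ)
    (h : l + A.rank + B.rank ≤ d) :
    ∃ W : Matrix (Fin d) (Fin l) ℂ, Wᴴ * W = 1 ∧ A * W = 0 ∧ B * W = 0 := by
  have hrank (M : Matrix (Fin d) (Fin d) ℂ) :
      M.rank + Module.finrank ℂ (LinearMap.ker M.toEuclideanLin) = d := by
    have := M.toEuclideanLin.finrank_range_add_finrank_ker
    rwa [finrank_euclideanSpace_fin, Matrix.toEuclideanLin_eq_toLin_orthonormal,
      ← Matrix.rank_eq_finrank_range_toLin M (EuclideanSpace.basisFun (Fin d) ℂ).toBasis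
        (EuclideanSpace.basisFun (Fin d) ℂ).toBasis] at this
  set S := LinearMap.ker A.toEuclideanLin ⊓ LinearMap.ker B.toEuclideanLin
  have hS : l ≤ Module.finrank ℂ S := by
    have h1 := Submodule.finrank_sup_add_finrank_inf_eq (LinearMap.ker A.toEuclideanLin)
      (LinearMap.ker B.toEuclideanLin)
    have h2 := Submodule.finrank_le
      (LinearMap.ker A.toEuclideanLin ⊔ LinearMap.ker B.toEuclideanLin)
    rw [finrank_euclideanSpace_fin] at h2
    change l ≤ Module.finrank ℂ ↥(LinearMap.ker A.toEuclideanLin ⊓ LinearMap.ker B.toEuclideanLin)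
    have := hrank A
    have := hrank B
    omega
  let b := stdOrthonormalBasis ℂ S
  let v (j : Fin l) : S := b (Fin.castLE hS j)
  have hv : Orthonormal ℂ v := b.orthonormal.comp _ (Fin.castLE_injective hS)
  have hmem (M : Matrix (Fin d) (Fin d) ℂ) (hM : S ≤ LinearMap.ker M.toEuclideanLin) :
      M * Matrix.of (fun i j => (v j : EuclideanSpace ℂ (Fin d)) i) = 0 := by
    ext i j
    have := congrArg (fun x : EuclideanSpace ℂ (Fin d) => x i) (hM (v j).2)
    simpa [Matrix.mul_apply, Matrix.mulVec, dotProduct] using this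
  refine ⟨Matrix.of fun i j => (v j : EuclideanSpace ℂ (Fin d)) i, ?_,
    hmem A inf_le_left, hmem B inf_le_right⟩
  ext i j
  have := orthonormal_iff_ite.mp hv i j
  rw [Submodule.coe_inner, PiLp.inner_apply] at this
  simpa [Matrix.mul_apply, Matrix.one_apply, mul_comm] using this

theorem IsProjn.mul_eq_zero_of_add {d l : ℕ} {P₁ P₂ P₃ : Matrix (Fin d) (Fin d) ℂ}
    (h₁ : IsProjn P₁) (h₂ : IsProjn P₂) (h₃ : IsProjn P₃) {W : Matrix (Fin d) (Fin l) ℂ}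
    (h : (P₁ + P₂ + P₃) * W = 0) : P₁ * W = 0 ∧ P₂ * W = 0 ∧ P₃ * W = 0 := by
  have hsq {P : Matrix (Fin d) (Fin d) ℂ} (hP : IsProjn P) :
      Wᴴ * (P * W) = (P * W)ᴴ * (P * W) := by
    rw [conjTranspose_mul, hP.1.eq, Matrix.mul_assoc, ← Matrix.mul_assoc P P, hP.2]
  have hsum : ((P₁ * W)ᴴ * (P₁ * W)).trace.re + ((P₂ * W)ᴴ * (P₂ * W)).trace.re +
      ((P₃ * W)ᴴ * (P₃ * W)).trace.re = 0 := by
    rw [← hsq h₁, ← hsq h₂, ← hsq h₃, ← Complex.add_re, ← Complex.add_re, ← trace_add,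
      ← trace_add, ← Matrix.mul_add, ← Matrix.mul_add, ← Matrix.add_mul, ← Matrix.add_mul, h]
    simp
  have hnn (A : Matrix (Fin d) (Fin l) ℂ) : 0 ≤ (Aᴴ * A).trace.re :=
    (Complex.le_def.mp (posSemidef_conjTranspose_mul_self A).trace_nonneg).1
  have n₁ := hnn (P₁ * W)
  have n₂ := hnn (P₂ * W)
  have n₃ := hnn (P₃ * W)
  refine ⟨?_, ?_, ?_⟩ <;> refine eq_zero_of_re_trace_conjTranspose_mul_self ?_ <;> linarith

theorem isProjn_mul_conjTranspose {d l : ℕ} {W : Matrix (Fin d) (Fin l) ℂ} (hW : Wᴴ * W = 1) :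
    IsProjn (W * Wᴴ) ∧ (W * Wᴴ).trace = l := by
  refine ⟨⟨isHermitian_mul_conjTranspose_self W, ?_⟩, ?_⟩
  · rw [Matrix.mul_assoc, ← Matrix.mul_assoc Wᴴ, hW, Matrix.one_mul]
  · rw [trace_mul_comm, hW]
    simp

theorem IsProjn.one_sub {d : ℕ} {P : Matrix (Fin d) (Fin d) ℂ} (hP : IsProjn P) :
    IsProjn (1 - P) := by
  refine ⟨isHermitian_one.sub hP.1, ?_⟩
  simp [Matrix.sub_mul, Matrix.mul_sub, hP.2]

theorem IsProjn.exists_isometry {d e : ℕ} {Q : Matrix (Fin d) (Fin d) ℂ} (hQ : IsProjn Q)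
    (he : Q.trace = e) : ∃ V : Matrix (Fin d) (Fin e) ℂ, Vᴴ * V = 1 ∧ V * Vᴴ = Q := by
  have hrank : e + (1 - Q).rank = d := by
    have h := hQ.one_sub.trace_eq_rank
    rw [trace_sub, trace_one, Fintype.card_fin, he, sub_eq_iff_eq_add'] at h
    exact_mod_cast h.symm
  obtain ⟨V, hV, hQV, -⟩ := exists_isometry_mul_eq_zero (l := e) (1 - Q) 0 (by simp [hrank])
  refine ⟨V, hV, ?_⟩
  have hQV' : Q * V = V := by
    rw [Matrix.sub_mul, Matrix.one_mul, sub_eq_zero] at hQV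
    exact hQV.symm
  obtain ⟨hF, hFt⟩ := isProjn_mul_conjTranspose hV
  have hQF : Q * (V * Vᴴ) = V * Vᴴ := by rw [← Matrix.mul_assoc, hQV']
  have hFQ : V * Vᴴ * Q = V * Vᴴ := by
    have := congrArg conjTranspose hQF
    rwa [conjTranspose_mul, hQ.1.eq, hF.1.eq] at this
  have hsq : (Q - V * Vᴴ)ᴴ * (Q - V * Vᴴ) = Q - V * Vᴴ := by
    rw [conjTranspose_sub, hQ.1.eq, hF.1.eq, Matrix.sub_mul, Matrix.mul_sub, Matrix.mul_sub, hQ.2,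
      hF.2, hQF, hFQ]
    simp
  refine (sub_eq_zero.mp (trace_conjTranspose_mul_self_eq_zero_iff.mp ?_)).symm
  rw [hsq, trace_sub, he, hFt, sub_self]

/-- Compressing projections to the range of a projection commuting with them. -/
theorem mem_smul_corrSet_of_commute {d e r₁ r₂ r₃ : ℕ} {Q P₁ P₂ P₃ : Matrix (Fin d) (Fin d) ℂ}
    (he : 0 < e) (hQ : IsProjn Q) (hQe : Q.trace = e)
    (h₁ : IsProjn P₁) (h₂ : IsProjn P₂) (h₃ : IsProjn P₃)
    (c₁ : P₁ * Q = Q * P₁) (c₂ : P₂ * Q = Q * P₂) (c₃ : P₃ * Q = Q * P₃)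
    (t₁ : (P₁ * Q).trace = r₁) (t₂ : (P₂ * Q).trace = r₂) (t₃ : (P₃ * Q).trace = r₃)
    (t₁₂ : (P₁ * P₂ * Q).trace = (P₁ * P₂).trace) (t₁₃ : (P₁ * P₃ * Q).trace = (P₁ * P₃).trace)
    (t₂₃ : (P₂ * P₃ * Q).trace = (P₂ * P₃).trace) :
    ((1 / (d : ℝ)) * ((P₁ * P₂).trace).re, (1 / (d : ℝ)) * ((P₁ * P₃).trace).re,
      (1 / (d : ℝ)) * ((P₂ * P₃).trace).re) ∈ ((e : ℝ) / d) • corrSet e r₁ r₂ r₃ := by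
  obtain ⟨V, hV, rfl⟩ := hQ.exists_isometry hQe
  have hprod (A B : Matrix (Fin d) (Fin d) ℂ) (hB : B * (V * Vᴴ) = V * Vᴴ * B) :
      Vᴴ * A * V * (Vᴴ * B * V) = Vᴴ * (A * B) * V := by
    calc Vᴴ * A * V * (Vᴴ * B * V) = Vᴴ * A * (V * Vᴴ * B) * V := by simp only [Matrix.mul_assoc]
      _ = Vᴴ * A * B * V * (Vᴴ * V) := by rw [← hB]; simp only [Matrix.mul_assoc]
      _ = Vᴴ * (A * B) * V := by rw [hV, Matrix.mul_one, Matrix.mul_assoc Vᴴ]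
  have htr (A : Matrix (Fin d) (Fin d) ℂ) : (Vᴴ * A * V).trace = (A * (V * Vᴴ)).trace := by
    rw [Matrix.mul_assoc, trace_mul_comm, Matrix.mul_assoc]
  have hproj {P : Matrix (Fin d) (Fin d) ℂ} (hP : IsProjn P) (hc : P * (V * Vᴴ) = V * Vᴴ * P) :
      IsProjn (Vᴴ * P * V) := by
    refine ⟨isHermitian_conjTranspose_mul_mul V hP.1, ?_⟩
    rw [hprod _ _ hc, hP.2]
  have hrank {P : Matrix (Fin d) (Fin d) ℂ} {r : ℕ} (hP : IsProjn P)
      (hc : P * (V * Vᴴ) = V * Vᴴ * P) (ht : (P * (V * Vᴴ)).trace = r) :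
      (Vᴴ * P * V).rank = r := by
    have h := (hproj hP hc).trace_eq_rank
    rw [htr, ht] at h
    exact_mod_cast h.symm
  refine Set.mem_smul_set.mpr ⟨_, ⟨Vᴴ * P₁ * V, Vᴴ * P₂ * V, Vᴴ * P₃ * V, hproj h₁ c₁, hproj h₂ c₂,
    hproj h₃ c₃, hrank h₁ c₁ t₁, hrank h₂ c₂ t₂, hrank h₃ c₃ t₃, rfl⟩, ?_⟩
  have he' : (e : ℝ) ≠ 0 := by exact_mod_cast he.ne'
  rw [hprod _ _ c₂, hprod _ _ c₃, hprod _ _ c₃, htr, htr, htr, t₁₂, t₁₃, t₂₃]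
  simp only [Prod.smul_mk, smul_eq_mul]
  ext <;> dsimp only <;> field_simp

theorem Matrix.eq_zero_of_mul_eq_zero_of_rank {d l : ℕ} {A : Matrix (Fin d) (Fin d) ℂ}
    {X : Matrix (Fin d) (Fin l) ℂ} (hA : d ≤ A.rank) (h : A * X = 0) : X = 0 := by
  have hr := Matrix.rank_add_rank_le_card_of_mul_eq_zero h
  rw [Fintype.card_fin] at hr
  have h0 : X.rank = 0 := by omega
  rw [Matrix.rank, Submodule.finrank_eq_zero, LinearMap.range_eq_bot] at h0
  ext i j
  simpa using congrFun (LinearMap.congr_fun h0 (Pi.single j 1)) i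

theorem Matrix.mul_mul_eq_zero_of_commute {d l : ℕ} {P A B : Matrix (Fin d) (Fin d) ℂ}
    {W : Matrix (Fin d) (Fin l) ℂ} {a b : ℝ} (hb : b ≠ 0)
    (h : P * (a • A + b • B) = (a • A + b • B) * P) (hP : P * W = 0) (hA : A * W = 0) :
    P * (B * W) = 0 := by
  have h' := congrArg (· * W) h
  simp only [Matrix.mul_assoc, Matrix.add_mul, Matrix.smul_mul, hP, hA, Matrix.mul_zero, smul_zero,
    zero_add, Matrix.mul_smul] at h'
  exact (smul_eq_zero.mp h').resolve_left hb

/-- A common kernel vector splits off one dimension. -/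
theorem IsProjn.mem_smul_corrSet_of_common_ker {d r₁ r₂ r₃ : ℕ}
    {P₁ P₂ P₃ : Matrix (Fin d) (Fin d) ℂ} (hd : 1 < d)
    (h₁ : IsProjn P₁) (h₂ : IsProjn P₂) (h₃ : IsProjn P₃)
    (r₁' : P₁.rank = r₁) (r₂' : P₂.rank = r₂) (r₃' : P₃.rank = r₃)
    {W : Matrix (Fin d) (Fin 1) ℂ} (hW : Wᴴ * W = 1)
    (z₁ : P₁ * W = 0) (z₂ : P₂ * W = 0) (z₃ : P₃ * W = 0) :
    ((1 / (d : ℝ)) * ((P₁ * P₂).trace).re, (1 / (d : ℝ)) * ((P₁ * P₃).trace).re,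
      (1 / (d : ℝ)) * ((P₂ * P₃).trace).re) ∈
      (((d - 1 : ℕ) : ℝ) / d) • corrSet (d - 1) r₁ r₂ r₃ := by
  obtain ⟨hF, hFt⟩ := isProjn_mul_conjTranspose hW
  have hright {P : Matrix (Fin d) (Fin d) ℂ} (hz : P * W = 0) : P * (1 - W * Wᴴ) = P := by
    rw [Matrix.mul_sub, ← Matrix.mul_assoc, hz]
    simp
  have hleft {P : Matrix (Fin d) (Fin d) ℂ} (hP : IsProjn P) (hz : P * W = 0) :
      (1 - W * Wᴴ) * P = P := by
    simpa [hP.1.eq, hF.1.eq] using congrArg conjTranspose (hright hz)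
  refine mem_smul_corrSet_of_commute (Q := 1 - W * Wᴴ) (by omega) hF.one_sub ?_ h₁ h₂ h₃
    ?_ ?_ ?_ ?_ ?_ ?_ ?_ ?_ ?_
  · rw [trace_sub, hFt, trace_one, Fintype.card_fin, Nat.cast_sub hd.le]
  · rw [hright z₁, hleft h₁ z₁]
  · rw [hright z₂, hleft h₂ z₂]
  · rw [hright z₃, hleft h₃ z₃]
  · rw [hright z₁, h₁.trace_eq_rank, r₁']
  · rw [hright z₂, h₂.trace_eq_rank, r₂']
  · rw [hright z₃, h₃.trace_eq_rank, r₃']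
  · rw [Matrix.mul_assoc, hright z₂]
  · rw [Matrix.mul_assoc, hright z₃]
  · rw [Matrix.mul_assoc, hright z₃]

/-- Orthogonal subspaces of the ranges of `P₂` and `P₃` that are killed by the other two
projections split off. -/
theorem IsProjn.mem_smul_corrSet_of_private_range {d l r₁ r₂ r₃ : ℕ}
    {P₁ P₂ P₃ : Matrix (Fin d) (Fin d) ℂ} (hd : 2 * l < d)
    (h₁ : IsProjn P₁) (h₂ : IsProjn P₂) (h₃ : IsProjn P₃)
    (r₁' : P₁.rank = r₁) (r₂' : P₂.rank = r₂) (r₃' : P₃.rank = r₃) (hl₂ : l ≤ r₂) (hl₃ : l ≤ r₃)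
    {V W : Matrix (Fin d) (Fin l) ℂ} (hV : Vᴴ * V = 1) (hW : Wᴴ * W = 1)
    (v₁ : P₁ * V = 0) (v₂ : P₂ * V = V) (v₃ : P₃ * V = 0)
    (w₁ : P₁ * W = 0) (w₂ : P₂ * W = 0) (w₃ : P₃ * W = W) :
    ((1 / (d : ℝ)) * ((P₁ * P₂).trace).re, (1 / (d : ℝ)) * ((P₁ * P₃).trace).re,
      (1 / (d : ℝ)) * ((P₂ * P₃).trace).re) ∈
      (((d - 2 * l : ℕ) : ℝ) / d) • corrSet (d - 2 * l) r₁ (r₂ - l) (r₃ - l) := by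
  obtain ⟨hF, hFt⟩ := isProjn_mul_conjTranspose hV
  obtain ⟨hG, hGt⟩ := isProjn_mul_conjTranspose hW
  set F := V * Vᴴ with hFdef
  set G := W * Wᴴ with hGdef
  have f₁ : P₁ * F = 0 := by rw [hFdef, ← Matrix.mul_assoc, v₁, Matrix.zero_mul]
  have f₂ : P₂ * F = F := by rw [hFdef, ← Matrix.mul_assoc, v₂]
  have f₃ : P₃ * F = 0 := by rw [hFdef, ← Matrix.mul_assoc, v₃, Matrix.zero_mul]
  have g₁ : P₁ * G = 0 := by rw [hGdef, ← Matrix.mul_assoc, w₁, Matrix.zero_mul]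
  have g₂ : P₂ * G = 0 := by rw [hGdef, ← Matrix.mul_assoc, w₂, Matrix.zero_mul]
  have g₃ : P₃ * G = G := by rw [hGdef, ← Matrix.mul_assoc, w₃]
  clear_value F G
  have hadj {A B C : Matrix (Fin d) (Fin d) ℂ} (hA : A.IsHermitian) (hB : B.IsHermitian)
      (hC : C.IsHermitian) (h : A * B = C) : B * A = C := by
    simpa [hA.eq, hB.eq, hC.eq] using congrArg conjTranspose h
  have f₁' := hadj h₁.1 hF.1 isHermitian_zero f₁
  have f₂' := hadj h₂.1 hF.1 hF.1 f₂
  have f₃' := hadj h₃.1 hF.1 isHermitian_zero f₃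
  have g₁' := hadj h₁.1 hG.1 isHermitian_zero g₁
  have g₂' := hadj h₂.1 hG.1 isHermitian_zero g₂
  have g₃' := hadj h₃.1 hG.1 hG.1 g₃
  have hFG : F * G = 0 := by rw [← f₂', Matrix.mul_assoc, g₂, Matrix.mul_zero]
  have hGF : G * F = 0 := hadj hF.1 hG.1 isHermitian_zero hFG
  have hQ : IsProjn (1 - (F + G)) := by
    refine IsProjn.one_sub ⟨hF.1.add hG.1, ?_⟩
    rw [Matrix.add_mul, Matrix.mul_add, Matrix.mul_add, hF.2, hG.2, hFG, hGF]
    simp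
  have q₁ : P₁ * (1 - (F + G)) = P₁ := by simp [Matrix.mul_sub, Matrix.mul_add, f₁, g₁]
  have q₂ : P₂ * (1 - (F + G)) = P₂ - F := by simp [Matrix.mul_sub, Matrix.mul_add, f₂, g₂]
  have q₃ : P₃ * (1 - (F + G)) = P₃ - G := by simp [Matrix.mul_sub, Matrix.mul_add, f₃, g₃]
  refine mem_smul_corrSet_of_commute (Q := 1 - (F + G)) (by omega) hQ ?_ h₁ h₂ h₃
    ?_ ?_ ?_ ?_ ?_ ?_ ?_ ?_ ?_
  · rw [trace_sub, trace_add, hFt, hGt, trace_one, Fintype.card_fin, Nat.cast_sub hd.le]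
    push_cast
    ring
  · simp [Matrix.mul_sub, Matrix.mul_add, Matrix.sub_mul, Matrix.add_mul, f₁, g₁, f₁', g₁']
  · simp [Matrix.mul_sub, Matrix.mul_add, Matrix.sub_mul, Matrix.add_mul, f₂, g₂, f₂', g₂']
  · simp [Matrix.mul_sub, Matrix.mul_add, Matrix.sub_mul, Matrix.add_mul, f₃, g₃, f₃', g₃']
  · rw [q₁, h₁.trace_eq_rank, r₁']
  · rw [q₂, trace_sub, h₂.trace_eq_rank, r₂', hFt, Nat.cast_sub hl₂]
  · rw [q₃, trace_sub, h₃.trace_eq_rank, r₃', hGt, Nat.cast_sub hl₃]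
  · rw [Matrix.mul_assoc, q₂, Matrix.mul_sub, f₁, sub_zero]
  · rw [Matrix.mul_assoc, q₃, Matrix.mul_sub, g₁, sub_zero]
  · rw [Matrix.mul_assoc, q₃, Matrix.mul_sub, g₂, sub_zero]

/-- A linear functional strictly separating a point from a compact set can be chosen with all
coefficients nonzero. -/
theorem exists_separating_coeffs_ne_zero {U : Set (ℝ × ℝ × ℝ)} (hU : IsCompact U)
    {x : ℝ × ℝ × ℝ} (hx : x ∉ convexHull ℝ U) :
    ∃ a b c : ℝ, a ≠ 0 ∧ b ≠ 0 ∧ c ≠ 0 ∧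
      ∀ y ∈ U, a * y.1 + b * y.2.1 + c * y.2.2 < a * x.1 + b * x.2.1 + c * x.2.2 := by
  obtain ⟨f, u, hfu, hux⟩ := geometric_hahn_banach_closed_point (convex_convexHull ℝ U)
    (isCompact_convexHull_of_isCompact hU).isClosed hx
  have hf (y : ℝ × ℝ × ℝ) :
      f y = f (1, 0, 0) * y.1 + f (0, 1, 0) * y.2.1 + f (0, 0, 1) * y.2.2 := by
    have hy : y = y.1 • ((1, 0, 0) : ℝ × ℝ × ℝ) + y.2.1 • ((0, 1, 0) : ℝ × ℝ × ℝ) +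
        y.2.2 • ((0, 0, 1) : ℝ × ℝ × ℝ) := by ext <;> simp
    nth_rewrite 1 [hy]
    simp only [map_add, map_smul, smul_eq_mul]
    ring
  have hcont : Continuous fun y : ℝ × ℝ × ℝ => (y.1 + y.2.1 + y.2.2) - (x.1 + x.2.1 + x.2.2) := by
    fun_prop
  obtain ⟨M, hM⟩ := (hU.image hcont).bddAbove
  have hne (a : ℝ) : ∀ᶠ ε in nhdsWithin (0 : ℝ) (Set.Ioi 0), a + ε ≠ 0 := by
    by_cases ha : a = 0
    · filter_upwards [self_mem_nhdsWithin] with ε hε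
      simpa [ha] using (Set.mem_Ioi.mp hε).ne'
    · refine nhdsWithin_le_nhds (ContinuousAt.eventually_ne (by fun_prop) ?_)
      simpa using ha
  have hsmall : ∀ᶠ ε in nhdsWithin (0 : ℝ) (Set.Ioi 0), ε * M < f x - u := by
    refine nhdsWithin_le_nhds ?_
    have : ContinuousAt (fun ε : ℝ => ε * M) 0 := by fun_prop
    exact this.eventually_lt continuousAt_const (by simpa using hux)
  obtain ⟨ε, h1, h2, h3, hε, hpos⟩ := ((hne (f (1, 0, 0))).and ((hne (f (0, 1, 0))).and
    ((hne (f (0, 0, 1))).and (hsmall.and self_mem_nhdsWithin)))).exists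
  refine ⟨_, _, _, h1, h2, h3, fun y hy => ?_⟩
  have hyu := hfu y (subset_convexHull ℝ U hy)
  have hyM := mul_le_mul_of_nonneg_left (hM ⟨y, hy, rfl⟩) (Set.mem_Ioi.mp hpos).le
  have hfx := hf x
  have hfy := hf y
  dsimp only at hyM
  linarith

/-- Lemma 3.10 (iterated reduction for type II slices): if `2n + k = d − m` and
`l = min(k, m)`, then `S_d(n, n+k, n+k)` lies in the convex hull of
`((d−1)/d)·S_{d−1}(n, n+k, n+k)` and `((d−2l)/d)·S_{d−2l}(n, n+k−l, n+k−l)`. -/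
theorem corrSet_typeII_reduction (k n m d : ℕ)
    (hk : 0 < k) (hn : 0 < n) (hm : 0 < m) (hd : 0 < d)
    (hdm : 2 * n + k = d - m) (hmd : m ≤ d) :
    corrSet d n (n + k) (n + k) ⊆
      convexHull ℝ
        ((((d : ℝ) - 1) / (d : ℝ)) • corrSet (d - 1) n (n + k) (n + k) ∪
          (((d : ℝ) - 2 * (min k m : ℕ)) / (d : ℝ)) •
            corrSet (d - 2 * min k m) n (n + k - min k m) (n + k - min k m)) := by
  obtain ⟨l, hl⟩ : ∃ l, l = min k m := ⟨_, rfl⟩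
  have hlk : l ≤ k := hl ▸ min_le_left k m
  have hlm : l ≤ m := hl ▸ min_le_right k m
  rw [← hl]
  have hd1 : (d : ℝ) - 1 = ((d - 1 : ℕ) : ℝ) := by
    rw [Nat.cast_sub hd, Nat.cast_one]
  have hd2 : (d : ℝ) - 2 * (l : ℝ) = ((d - 2 * l : ℕ) : ℝ) := by
    rw [Nat.cast_sub (by omega)]
    push_cast
    ring
  rw [hd1, hd2]
  intro x hx
  by_contra hxU
  obtain ⟨a, b, c, ha, hb, hc, hsep⟩ := exists_separating_coeffs_ne_zero
    (((isCompact_corrSet _ _ _ _).smul _).union ((isCompact_corrSet _ _ _ _).smul _)) hxU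
  have hcont : Continuous fun y : ℝ × ℝ × ℝ => a * y.1 + b * y.2.1 + c * y.2.2 := by fun_prop
  obtain ⟨z, hz, hzmax⟩ :=
    (isCompact_corrSet d n (n + k) (n + k)).exists_isMaxOn ⟨x, hx⟩ hcont.continuousOn
  refine (hsep z ?_).not_ge (hzmax hx)
  obtain ⟨P₁, P₂, P₃, h₁, h₂, h₃, r₁, r₂, r₃, rfl⟩ := hz
  have hmax (Q₁ Q₂ Q₃ : Matrix (Fin d) (Fin d) ℂ) (q₁ : IsProjn Q₁) (q₂ : IsProjn Q₂)
      (q₃ : IsProjn Q₃) (s₁ : Q₁.rank = n) (s₂ : Q₂.rank = n + k) (s₃ : Q₃.rank = n + k) :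
      a * ((Q₁ * Q₂).trace).re + b * ((Q₁ * Q₃).trace).re + c * ((Q₂ * Q₃).trace).re ≤
        a * ((P₁ * P₂).trace).re + b * ((P₁ * P₃).trace).re + c * ((P₂ * P₃).trace).re := by
    have h : a * _ + b * _ + c * _ ≤ a * _ + b * _ + c * _ :=
      hzmax ⟨Q₁, Q₂, Q₃, q₁, q₂, q₃, s₁, s₂, s₃, rfl⟩
    have hdpos : 0 < 1 / (d : ℝ) := by positivity
    refine le_of_mul_le_mul_left ?_ hdpos
    dsimp only at h
    linarith
  have hherm (s t : ℝ) {A B : Matrix (Fin d) (Fin d) ℂ} (hA : IsProjn A) (hB : IsProjn B) :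
      (s • A + t • B).IsHermitian := by
    rw [Matrix.IsHermitian, conjTranspose_add, conjTranspose_smul, conjTranspose_smul, hA.1.eq,
      hB.1.eq, star_trivial, star_trivial]
  have k₁ : P₁ * (a • P₂ + b • P₃) = (a • P₂ + b • P₃) * P₁ := by
    refine h₁.commute_of_forall_le (hherm _ _ h₂ h₃) fun Q hQ hr => ?_
    have := hmax Q P₂ P₃ hQ h₂ h₃ (hr.trans r₁) r₂ r₃
    simp only [Matrix.mul_add, Matrix.mul_smul, trace_add, trace_smul, Complex.add_re,
      Complex.smul_re, smul_eq_mul]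
    linarith
  have k₂ : P₂ * (a • P₁ + c • P₃) = (a • P₁ + c • P₃) * P₂ := by
    refine h₂.commute_of_forall_le (hherm _ _ h₁ h₃) fun Q hQ hr => ?_
    have := hmax P₁ Q P₃ h₁ hQ h₃ r₁ (hr.trans r₂) r₃
    simp only [Matrix.mul_add, Matrix.mul_smul, trace_add, trace_smul, Complex.add_re,
      Complex.smul_re, smul_eq_mul]
    rw [trace_mul_comm Q P₁, trace_mul_comm P₂ P₁]
    linarith
  have k₃ : P₃ * (b • P₁ + c • P₂) = (b • P₁ + c • P₂) * P₃ := by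
    refine h₃.commute_of_forall_le (hherm _ _ h₁ h₂) fun Q hQ hr => ?_
    have := hmax P₁ P₂ Q h₁ h₂ hQ r₁ r₂ (hr.trans r₃)
    simp only [Matrix.mul_add, Matrix.mul_smul, trace_add, trace_smul, Complex.add_re,
      Complex.smul_re, smul_eq_mul]
    rw [trace_mul_comm Q P₁, trace_mul_comm P₃ P₁, trace_mul_comm Q P₂, trace_mul_comm P₃ P₂]
    linarith
  by_cases hfull : d ≤ (P₁ + P₂ + P₃).rank
  · right
    obtain ⟨V, hV, v₁, v₃⟩ := exists_isometry_mul_eq_zero (l := l) P₁ P₃ (by omega)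
    obtain ⟨W, hW, w₁, w₂⟩ := exists_isometry_mul_eq_zero (l := l) P₁ P₂ (by omega)
    refine IsProjn.mem_smul_corrSet_of_private_range (by omega) h₁ h₂ h₃ r₁ r₂ r₃ (by omega)
      (by omega) hV hW v₁ ?_ v₃ w₁ w₂ ?_
    · have u₁ := mul_mul_eq_zero_of_commute ha (by rwa [add_comm] at k₁) v₁ v₃
      have u₃ := mul_mul_eq_zero_of_commute hc k₃ v₃ v₁
      refine sub_eq_zero.mp (eq_zero_of_mul_eq_zero_of_rank hfull ?_)
      rw [Matrix.mul_sub]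
      simp only [Matrix.add_mul, u₁, u₃, v₁, v₃, ← Matrix.mul_assoc P₂ P₂, h₂.2]
      simp
    · have u₁ := mul_mul_eq_zero_of_commute hb k₁ w₁ w₂
      have u₂ := mul_mul_eq_zero_of_commute hc k₂ w₂ w₁
      refine sub_eq_zero.mp (eq_zero_of_mul_eq_zero_of_rank hfull ?_)
      rw [Matrix.mul_sub]
      simp only [Matrix.add_mul, u₁, u₂, w₁, w₂, ← Matrix.mul_assoc P₃ P₃, h₃.2]
      simp
  · left
    obtain ⟨W, hW, hz, -⟩ := exists_isometry_mul_eq_zero (l := 1) (P₁ + P₂ + P₃) 0 (by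
      rw [Matrix.rank_zero]
      omega)
    obtain ⟨z₁, z₂, z₃⟩ := h₁.mul_eq_zero_of_add h₂ h₃ hz
    exact h₁.mem_smul_corrSet_of_common_ker (by omega) h₂ h₃ r₁ r₂ r₃ hW z₁ z₂ z₃
end

section
/- Let n, k, d be positive integers with 2(n+k) ≤ d. Define A₁ := max(0, (6n+4k−2d)/d)·S₂(1) and A₂ := (2n/d)·S₂(1) + ({0}×{0}×[0, k/d]). Then S_d(n, n+k, n+k) ⊆ co{A₁, A₂}. -/
open Matrix
open scoped Pointwise ComplexOrder

/-- `(x, y, z)` lies in the convex cone over `{1} × 2 • corrSet 2 1 1 1`, at height `m`: the Gram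
matrix of three Bloch vectors of length `m` attached to it is positive semidefinite. -/
def IsBloch (m x y z : ℝ) : Prop :=
  ∀ r s t : ℝ, 0 ≤ m * (r ^ 2 + s ^ 2 + t ^ 2) +
    2 * ((2 * x - m) * (r * s) + (2 * y - m) * (r * t) + (2 * z - m) * (s * t))

theorem IsBloch.nonneg {m x y z : ℝ} (h : IsBloch m x y z) : 0 ≤ m := by
  simpa using h 1 0 0

theorem isBloch_zero : IsBloch 0 0 0 0 := fun r s t => by simp

theorem IsBloch.eq_zero {x y z : ℝ} (h : IsBloch 0 x y z) : x = 0 ∧ y = 0 ∧ z = 0 := by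
  have h1 := h 1 1 0
  have h2 := h 1 (-1) 0
  have h3 := h 1 0 1
  have h4 := h 1 0 (-1)
  have h5 := h 0 1 1
  have h6 := h 0 1 (-1)
  norm_num at h1 h2 h3 h4 h5 h6
  refine ⟨?_, ?_, ?_⟩ <;> linarith

theorem IsBloch.add {m x y z m' x' y' z' : ℝ} (h : IsBloch m x y z) (h' : IsBloch m' x' y' z') :
    IsBloch (m + m') (x + x') (y + y') (z + z') := fun r s t => by
  linear_combination h r s t + h' r s t

theorem IsBloch.smul {m x y z c : ℝ} (hc : 0 ≤ c) (h : IsBloch m x y z) :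
    IsBloch (c * m) (c * x) (c * y) (c * z) := fun r s t => by
  linear_combination c * h r s t

/-- Adding the four commuting vertices and the barycenter of the elliptope. -/
theorem IsBloch.add_vertices {m x y z a b c e f : ℝ} (h : IsBloch m x y z) (ha : 0 ≤ a)
    (hb : 0 ≤ b) (hc : 0 ≤ c) (he : 0 ≤ e) (hf : 0 ≤ f) :
    IsBloch (m + a + b + c + e + 2 * f) (x + a + e + f) (y + b + e + f) (z + c + e + f) :=
  fun r s t => by
    linear_combination h r s t + a * sq_nonneg (r + s - t) + b * sq_nonneg (r + t - s) +
      c * sq_nonneg (s + t - r) + e * sq_nonneg (r + s + t) +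
      2 * f * (sq_nonneg r + sq_nonneg s + sq_nonneg t)

/-- The trace data of three operators (dimension, three traces, three traces of pairwise products)
is a nonnegative combination of the data of irreducible triples of projections: two-dimensional
triples of rank-one projections, and the eight one-dimensional triples. -/
def IsBlockSum (D a p q x y z : ℝ) : Prop :=
  ∃ m X Y Z w₀ w₁ w₂ w₃ w₁₂ w₁₃ w₂₃ w₁₂₃ : ℝ, IsBloch m X Y Z ∧
    0 ≤ w₀ ∧ 0 ≤ w₁ ∧ 0 ≤ w₂ ∧ 0 ≤ w₃ ∧ 0 ≤ w₁₂ ∧ 0 ≤ w₁₃ ∧ 0 ≤ w₂₃ ∧ 0 ≤ w₁₂₃ ∧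
    D = 2 * m + w₀ + w₁ + w₂ + w₃ + w₁₂ + w₁₃ + w₂₃ + w₁₂₃ ∧
    a = m + w₁ + w₁₂ + w₁₃ + w₁₂₃ ∧ p = m + w₂ + w₁₂ + w₂₃ + w₁₂₃ ∧
    q = m + w₃ + w₁₃ + w₂₃ + w₁₂₃ ∧
    x = X + w₁₂ + w₁₂₃ ∧ y = Y + w₁₃ + w₁₂₃ ∧ z = Z + w₂₃ + w₁₂₃

theorem isBlockSum_zero : IsBlockSum 0 0 0 0 0 0 0 :=
  ⟨0, 0, 0, 0, 0, 0, 0, 0, 0, 0, 0, 0, isBloch_zero, by norm_num⟩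

theorem IsBlockSum.add {D a p q x y z D' a' p' q' x' y' z' : ℝ} (h : IsBlockSum D a p q x y z)
    (h' : IsBlockSum D' a' p' q' x' y' z') :
    IsBlockSum (D + D') (a + a') (p + p') (q + q') (x + x') (y + y') (z + z') := by
  obtain ⟨m, X, Y, Z, w₀, w₁, w₂, w₃, w₄, w₅, w₆, w₇, hB, h⟩ := h
  obtain ⟨m', X', Y', Z', v₀, v₁, v₂, v₃, v₄, v₅, v₆, v₇, hB', h'⟩ := h'
  refine ⟨m + m', X + X', Y + Y', Z + Z', w₀ + v₀, w₁ + v₁, w₂ + v₂, w₃ + v₃, w₄ + v₄, w₅ + v₅,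
    w₆ + v₆, w₇ + v₇, hB.add hB', ?_⟩
  refine ⟨?_, ?_, ?_, ?_, ?_, ?_, ?_, ?_, ?_, ?_, ?_, ?_, ?_, ?_, ?_⟩ <;> linarith

/-- A two-dimensional block where `P₂`, `P₃` are rank-one projections with overlap `z`, and where
`P₁ = l + m F` with `F` a rank-one projection with overlaps `X`, `Y`. -/
theorem isBlockSum_two {m l X Y z : ℝ} (hm : 0 ≤ m) (hl : 0 ≤ l) (hml : m + l ≤ 1)
    (h : IsBloch 1 X Y z) (hz : 0 ≤ z) (hz' : z ≤ 1) :
    IsBlockSum 2 (m + 2 * l) 1 1 (m * X + l) (m * Y + l) z := by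
  have hr : 0 ≤ 1 - m - l := by linarith
  have hz'' : 0 ≤ 1 - z := by linarith
  refine ⟨m * 1, m * X, m * Y, m * z, (1 - m - l) * z, l * z, (1 - m - l) * (1 - z),
    (1 - m - l) * (1 - z), l * (1 - z), l * (1 - z), (1 - m - l) * z, l * z, h.smul hm, ?_⟩
  refine ⟨by positivity, by positivity, by positivity, by positivity, by positivity,
    by positivity, by positivity, by positivity, ?_, ?_, ?_, ?_, ?_, ?_, ?_⟩ <;> ring

theorem isBlockSum_one {a p q : ℝ} (ha : 0 ≤ a) (ha' : a ≤ 1) (hp : p = 0 ∨ p = 1)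
    (hq : q = 0 ∨ q = 1) : IsBlockSum 1 a p q (a * p) (a * q) (p * q) := by
  have hp0 : 0 ≤ p ∧ 0 ≤ 1 - p := by rcases hp with rfl | rfl <;> norm_num
  have hq0 : 0 ≤ q ∧ 0 ≤ 1 - q := by rcases hq with rfl | rfl <;> norm_num
  have h1 : 0 ≤ 1 - a := by linarith
  obtain ⟨⟨hp0, hp1⟩, hq0, hq1⟩ := And.intro hp0 hq0
  refine ⟨0, 0, 0, 0, (1 - a) * ((1 - p) * (1 - q)), a * ((1 - p) * (1 - q)),
    (1 - a) * (p * (1 - q)), (1 - a) * ((1 - p) * q), a * (p * (1 - q)), a * ((1 - p) * q),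
    (1 - a) * (p * q), a * (p * q), isBloch_zero, ?_⟩
  refine ⟨by positivity, by positivity, by positivity, by positivity, by positivity,
    by positivity, by positivity, by positivity, ?_, ?_, ?_, ?_, ?_, ?_, ?_⟩ <;> ring

/-- Rearranging a block sum with ranks `n, n + k, n + k` into a single Bloch part and a multiple
of `(0, 0, 1)`. -/
theorem IsBlockSum.exists_isBloch {d n k x y z : ℝ}
    (h : IsBlockSum d n (n + k) (n + k) x y z) (hd : 2 * (n + k) ≤ d) (hk : 0 ≤ k) :
    ∃ u e Z, IsBloch u x y Z ∧ z = Z + e ∧ 0 ≤ e ∧ e ≤ k ∧ max 0 (3 * n + 2 * k - d) ≤ u ∧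
      u ≤ n ∧ (e = 0 ∨ u = n) := by
  obtain ⟨m, X, Y, Z, w₀, w₁, w₂, w₃, w₁₂, w₁₃, w₂₃, w₁₂₃, hB, h0, h1, h2, h3, h12, h13, h23,
    h123, eD, ea, ep, eq, rfl, rfl, rfl⟩ := h
  have hm := hB.nonneg
  have main : ∀ c₁₂ c₁₃ c₂₃ c₁₂₃ f e, 0 ≤ c₁₂ → 0 ≤ c₁₃ → 0 ≤ c₂₃ → 0 ≤ c₁₂₃ → 0 ≤ f →
      c₁₂ + c₁₂₃ + f = w₁₂ + w₁₂₃ → c₁₃ + c₁₂₃ + f = w₁₃ + w₁₂₃ →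
      c₂₃ + c₁₂₃ + f + e = w₂₃ + w₁₂₃ → 0 ≤ e → e ≤ k →
      3 * n + 2 * k - d ≤ m + c₁₂ + c₁₃ + c₂₃ + c₁₂₃ + 2 * f →
      m + c₁₂ + c₁₃ + c₂₃ + c₁₂₃ + 2 * f ≤ n →
      (e = 0 ∨ m + c₁₂ + c₁₃ + c₂₃ + c₁₂₃ + 2 * f = n) →
      ∃ u e Z', IsBloch u (X + w₁₂ + w₁₂₃) (Y + w₁₃ + w₁₂₃) Z' ∧ Z + w₂₃ + w₁₂₃ = Z' + e ∧
        0 ≤ e ∧ e ≤ k ∧ max 0 (3 * n + 2 * k - d) ≤ u ∧ u ≤ n ∧ (e = 0 ∨ u = n) := by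
    intro c₁₂ c₁₃ c₂₃ c₁₂₃ f e g12 g13 g23 g123 gf e12 e13 e23 he hek hl hu hor
    refine ⟨_, e, Z + c₂₃ + c₁₂₃ + f, ?_, ?_, he, hek, max_le (by positivity) hl, hu, hor⟩
    · have := hB.add_vertices g12 g13 g23 g123 gf
      rwa [show X + c₁₂ + c₁₂₃ + f = X + w₁₂ + w₁₂₃ by linarith,
        show Y + c₁₃ + c₁₂₃ + f = Y + w₁₃ + w₁₂₃ by linarith] at this
    · linarith
  rcases lt_or_ge w₀ w₁₂₃ with hA | hA
  · apply main w₁₂ w₁₃ w₂₃ w₀ (w₁₂₃ - w₀) 0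
    all_goals first | linarith | exact Or.inl rfl
  rcases le_total w₂₃ w₁ with hB' | hB'
  · apply main w₁₂ w₁₃ w₂₃ w₁₂₃ 0 0
    all_goals first | linarith | exact Or.inl rfl
  rcases le_total (w₂₃ - w₁) k with hC | hC
  · apply main w₁₂ w₁₃ w₁ w₁₂₃ 0 (w₂₃ - w₁)
    all_goals first | linarith | exact Or.inr (by linarith)
  · apply main (w₁₂ - (w₂₃ - w₁ - k)) (w₁₃ - (w₂₃ - w₁ - k)) w₁ w₁₂₃ (w₂₃ - w₁ - k) k
    all_goals first | linarith | exact Or.inr (by linarith)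

section Operators

open Module

variable {E : Type*} [NormedAddCommGroup E] [InnerProductSpace ℂ E]

theorem LinearMap.IsSymmetric.apply_mem_orthogonal {X : E →ₗ[ℂ] E} (h : X.IsSymmetric)
    {W : Submodule ℂ E} (hW : ∀ w ∈ W, X w ∈ W) : ∀ w ∈ Wᗮ, X w ∈ Wᗮ := fun w hw => by
  rw [Submodule.mem_orthogonal] at hw ⊢
  intro u hu
  rw [← h]
  exact hw _ (hW u hu)

/-- A rank-one operator onto a unit vector. -/
theorem isSymmetricProjection_rankOne {v : E} (hv : ‖v‖ = 1) :
    (InnerProductSpace.rankOne ℂ v v).toLinearMap.IsSymmetricProjection := by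
  constructor
  · ext x
    simp [inner_self_eq_norm_sq_to_K, hv]
  · intro x y
    simp [inner_smul_left, inner_smul_right, mul_comm]

theorem trace_mul_re_nonneg {P Q : E →ₗ[ℂ] E} (hP : P.IsSymmetricProjection)
    (hQ : Q.IsSymmetricProjection) : 0 ≤ (LinearMap.trace ℂ E (P * Q)).re := by
  have h : (P * Q * P).IsPositive := by
    refine ⟨fun x y => ?_, fun x => ?_⟩
    · simp only [Module.End.mul_apply]
      rw [hP.2, hQ.2, hP.2]
    · simp only [Module.End.mul_apply]
      rw [hP.2]
      exact hQ.isPositive.2 _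
  have := h.trace_nonneg
  rw [LinearMap.trace_mul_comm, ← mul_assoc, hP.1.eq] at this
  exact (Complex.nonneg_iff.mp this).1

theorem LinearMap.IsSymmetricProjection.one_sub {P : E →ₗ[ℂ] E} (hP : P.IsSymmetricProjection) :
    (1 - P).IsSymmetricProjection :=
  ⟨hP.1.one_sub, .sub .one hP.2⟩

theorem trace_eq_one_of_apply_notMem_span (hE : finrank ℂ E = 2) {P : E →ₗ[ℂ] E}
    (hP : IsIdempotentElem P) {v : E} (hv : P v ∉ ℂ ∙ v) : LinearMap.trace ℂ E P = 1 := by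
  have : FiniteDimensional ℂ E := Module.finite_of_finrank_pos (by omega)
  rw [(LinearMap.IsIdempotentElem.isProj_range P hP).trace]
  have h0 : finrank ℂ (LinearMap.range P) ≠ 0 := by
    rw [Ne, Submodule.finrank_eq_zero, LinearMap.range_eq_bot]
    rintro rfl
    simp at hv
  have h2 : finrank ℂ (LinearMap.range P) ≠ 2 := by
    intro h
    have htop : LinearMap.range P = ⊤ := Submodule.eq_top_of_finrank_eq (by rw [h, hE])
    obtain ⟨w, hw⟩ : v ∈ LinearMap.range P := by rw [htop]; trivial
    apply hv
    rw [← hw, ← Module.End.mul_apply, hP.eq]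
    exact Submodule.mem_span_singleton_self _
  have hle := Submodule.finrank_le (LinearMap.range P)
  have : finrank ℂ (LinearMap.range P) = 1 := by omega
  simp [this]

variable [FiniteDimensional ℂ E]

/-- The compression of an operator to a subspace. -/
noncomputable def compress (W : Submodule ℂ E) (X : E →ₗ[ℂ] E) : W →ₗ[ℂ] W :=
  W.orthogonalProjectionOnto.toLinearMap ∘ₗ X ∘ₗ W.subtype

theorem compress_apply (W : Submodule ℂ E) (X : E →ₗ[ℂ] E) (w : W) :
    compress W X w = W.orthogonalProjectionOnto (X w) := rfl

theorem coe_compress_apply {W : Submodule ℂ E} {X : E →ₗ[ℂ] E} (h : ∀ w ∈ W, X w ∈ W) (w : W) :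
    (compress W X w : E) = X w :=
  Submodule.starProjection_eq_self_iff.mpr (h w w.2)

theorem inner_compress_apply (W : Submodule ℂ E) (X : E →ₗ[ℂ] E) (v w : W) :
    inner ℂ (compress W X v) w = inner ℂ (X v) (w : E) := by
  rw [compress_apply, Submodule.inner_orthogonalProjectionOnto_eq_of_mem_right]

theorem compress_one_sub (W : Submodule ℂ E) (X : E →ₗ[ℂ] E) :
    1 - compress W X = compress W (1 - X) := by
  ext w
  simp [compress_apply]

theorem compress_mul {W : Submodule ℂ E} (X : E →ₗ[ℂ] E) {Y : E →ₗ[ℂ] E}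
    (h : ∀ w ∈ W, Y w ∈ W) : compress W (X * Y) = compress W X * compress W Y := by
  ext w
  rw [Module.End.mul_apply, compress_apply, compress_apply, coe_compress_apply h,
    Module.End.mul_apply]

theorem LinearMap.IsSymmetric.compress {X : E →ₗ[ℂ] E} (h : X.IsSymmetric) (W : Submodule ℂ E) :
    (compress W X).IsSymmetric := fun v w => by
  rw [inner_compress_apply, h, ← inner_conj_symm v, inner_compress_apply, inner_conj_symm]

theorem LinearMap.IsPositive.compress {X : E →ₗ[ℂ] E} (h : X.IsPositive) (W : Submodule ℂ E) :
    (compress W X).IsPositive :=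
  ⟨h.1.compress W, fun w => by rw [inner_compress_apply]; exact h.2 w⟩

theorem LinearMap.IsSymmetricProjection.compress {X : E →ₗ[ℂ] E} (h : X.IsSymmetricProjection)
    {W : Submodule ℂ E} (hW : ∀ w ∈ W, X w ∈ W) : (compress W X).IsSymmetricProjection :=
  ⟨by rw [IsIdempotentElem, ← compress_mul X hW, h.1.eq], h.2.compress W⟩

theorem trace_compress_add_trace_compress (W : Submodule ℂ E) (X : E →ₗ[ℂ] E) :
    LinearMap.trace ℂ W (compress W X) + LinearMap.trace ℂ Wᗮ (compress Wᗮ X) =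
      LinearMap.trace ℂ E X := by
  unfold compress
  rw [LinearMap.trace_comp_comm' (X ∘ₗ W.subtype), LinearMap.trace_comp_comm' (X ∘ₗ Wᗮ.subtype), ← map_add,
    LinearMap.comp_assoc, LinearMap.comp_assoc, ← LinearMap.comp_add]
  congr 1
  ext x
  simp only [LinearMap.comp_apply, LinearMap.add_apply]
  congr 1
  exact (Submodule.starProjection_add_starProjection_orthogonal (K := W) x)

/-- `IsBlockSum` for the trace data of a triple of operators. -/
def HasBlockSum (A P Q : E →ₗ[ℂ] E) : Prop :=
  IsBlockSum (finrank ℂ E) (LinearMap.trace ℂ E A).re (LinearMap.trace ℂ E P).re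
    (LinearMap.trace ℂ E Q).re (LinearMap.trace ℂ E (A * P)).re (LinearMap.trace ℂ E (A * Q)).re
    (LinearMap.trace ℂ E (P * Q)).re

theorem HasBlockSum.of_compress {A P Q : E →ₗ[ℂ] E} {W : Submodule ℂ E} (hP : P.IsSymmetric)
    (hQ : Q.IsSymmetric) (hPW : ∀ w ∈ W, P w ∈ W) (hQW : ∀ w ∈ W, Q w ∈ W)
    (h : HasBlockSum (compress W A) (compress W P) (compress W Q))
    (h' : HasBlockSum (compress Wᗮ A) (compress Wᗮ P) (compress Wᗮ Q)) : HasBlockSum A P Q := by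
  have := IsBlockSum.add h h'
  rw [← compress_mul A hPW, ← compress_mul A hQW, ← compress_mul P hQW,
    ← compress_mul A (hP.apply_mem_orthogonal hPW), ← compress_mul A (hQ.apply_mem_orthogonal hQW),
    ← compress_mul P (hQ.apply_mem_orthogonal hQW)] at this
  simp only [← Complex.add_re, trace_compress_add_trace_compress, ← Nat.cast_add,
    Submodule.finrank_add_finrank_orthogonal] at this
  exact this

theorem LinearMap.IsSymmetric.trace_mul_self_re_nonneg {X : E →ₗ[ℂ] E} (h : X.IsSymmetric) :
    0 ≤ (LinearMap.trace ℂ E (X * X)).re := by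
  rw [LinearMap.trace_eq_sum_inner _ (stdOrthonormalBasis ℂ E), Complex.re_sum]
  refine Finset.sum_nonneg fun i _ => ?_
  rw [Module.End.mul_apply, ← h]
  exact inner_self_nonneg (𝕜 := ℂ)

theorem isBloch_of_trace_eq_one (hE : finrank ℂ E = 2) {F P Q : E →ₗ[ℂ] E}
    (hF : F.IsSymmetricProjection) (hP : P.IsSymmetricProjection) (hQ : Q.IsSymmetricProjection)
    (hF1 : LinearMap.trace ℂ E F = 1) (hP1 : LinearMap.trace ℂ E P = 1)
    (hQ1 : LinearMap.trace ℂ E Q = 1) :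
    IsBloch 1 (LinearMap.trace ℂ E (F * P)).re (LinearMap.trace ℂ E (F * Q)).re
      (LinearMap.trace ℂ E (P * Q)).re := by
  intro r s t
  have hsymm : ∀ (c : ℝ) {X : E →ₗ[ℂ] E}, X.IsSymmetric →
      ((c : ℂ) • (2 * X - 1)).IsSymmetric := by
    intro c X hX
    refine LinearMap.IsSymmetric.smul (by simp) (LinearMap.IsSymmetric.sub ?_ .one)
    rw [two_mul]
    exact hX.add hX
  have key := (((hsymm r hF.2).add (hsymm s hP.2)).add (hsymm t hQ.2)).trace_mul_self_re_nonneg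
  have e : ((r : ℂ) • (2 * F - 1) + (s : ℂ) • (2 * P - 1) + (t : ℂ) • (2 * Q - 1)) *
      ((r : ℂ) • (2 * F - 1) + (s : ℂ) • (2 * P - 1) + (t : ℂ) • (2 * Q - 1)) =
      ((r ^ 2 + s ^ 2 + t ^ 2 : ℝ) : ℂ) • (1 : E →ₗ[ℂ] E) +
      ((r * s : ℝ) : ℂ) • ((4 : ℂ) • (F * P + P * F) - (4 : ℂ) • F - (4 : ℂ) • P + (2 : ℂ) • 1) +
      ((r * t : ℝ) : ℂ) • ((4 : ℂ) • (F * Q + Q * F) - (4 : ℂ) • F - (4 : ℂ) • Q + (2 : ℂ) • 1) +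
      ((s * t : ℝ) : ℂ) •
        ((4 : ℂ) • (P * Q + Q * P) - (4 : ℂ) • P - (4 : ℂ) • Q + (2 : ℂ) • 1) := by
    have h1 := hF.1.eq
    have h2 := hP.1.eq
    have h3 := hQ.1.eq
    simp only [two_mul, add_mul, mul_add, sub_mul, mul_sub, smul_mul_assoc, mul_smul_comm, one_mul,
      mul_one, h1, h2, h3]
    push_cast
    module
  rw [e] at key
  simp only [map_add, map_sub, map_smul, LinearMap.trace_mul_comm ℂ P F,
    LinearMap.trace_mul_comm ℂ Q F, LinearMap.trace_mul_comm ℂ Q P, hF1, hP1, hQ1,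
    LinearMap.trace_one, hE, Complex.add_re, smul_eq_mul,
    Complex.sub_re, Complex.mul_re, Complex.ofReal_re, Complex.ofReal_im] at key
  norm_num at key
  linarith

theorem hasBlockSum_of_finrank_eq_two (hE : finrank ℂ E = 2) {A P Q : E →ₗ[ℂ] E}
    (hA : A.IsPositive) (hA' : (1 - A).IsPositive) (hP : P.IsSymmetricProjection)
    (hQ : Q.IsSymmetricProjection) (hP1 : LinearMap.trace ℂ E P = 1)
    (hQ1 : LinearMap.trace ℂ E Q = 1) : HasBlockSum A P Q := by
  have hz := trace_mul_re_nonneg hP hQ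
  have hz' := trace_mul_re_nonneg hP hQ.one_sub
  rw [mul_sub, mul_one, map_sub, hP1, Complex.sub_re, Complex.one_re, sub_nonneg] at hz'
  have key : ∀ (b : OrthonormalBasis (Fin 2) ℂ E) (i j : Fin 2) (l m : ℝ), i ≠ j →
      A (b i) = (l : ℂ) • b i → A (b j) = (m : ℂ) • b j → l ≤ m → HasBlockSum A P Q := by
    intro b i j l m hij hl hm hlm
    have hl0 : 0 ≤ l := by
      have := hA.2 (b i)
      rw [hl, inner_smul_left] at this
      simpa using this
    have hm1 : m ≤ 1 := by
      have := hA'.2 (b j)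
      rw [LinearMap.sub_apply, hm, inner_sub_left, inner_smul_left] at this
      simpa using this
    set F := (InnerProductSpace.rankOne ℂ (b j) (b j)).toLinearMap with hFdef
    have hF : F.IsSymmetricProjection := isSymmetricProjection_rankOne (b.norm_eq_one j)
    have hF1 : LinearMap.trace ℂ E F = 1 := by
      rw [hFdef, InnerProductSpace.trace_rankOne]
      simp
    have hAF : A = (l : ℂ) • 1 + ((m - l : ℝ) : ℂ) • F := by
      refine b.toBasis.ext fun a => ?_
      have ha : a = i ∨ a = j := by omega
      rcases ha with rfl | rfl
      · simp [hFdef, hl, b.inner_eq_zero hij.symm]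
      · simp [hFdef, hm, sub_smul]
    have := isBlockSum_two (sub_nonneg.mpr hlm) hl0 (by linarith)
      (isBloch_of_trace_eq_one hE hF hP hQ hF1 hP1 hQ1) hz hz'
    unfold HasBlockSum
    rw [hAF]
    simp only [add_mul, smul_mul_assoc, one_mul, map_add, map_smul, LinearMap.trace_one, hE, hF1,
      hP1, hQ1, smul_eq_mul, Complex.add_re, Complex.re_ofReal_mul]
    convert this using 1
    all_goals norm_num
    all_goals ring
  have hev := hA.1.apply_eigenvectorBasis hE
  rcases le_total (hA.1.eigenvalues hE 0) (hA.1.eigenvalues hE 1) with h | h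
  · exact key _ 0 1 _ _ (by decide) (hev 0) (hev 1) h
  · exact key _ 1 0 _ _ (by decide) (hev 1) (hev 0) h

theorem exists_eq_smul_one (hE : finrank ℂ E = 1) (X : E →ₗ[ℂ] E) : ∃ c : ℂ, X = c • 1 := by
  obtain ⟨v, hv, h⟩ := finrank_eq_one_iff'.mp hE
  obtain ⟨c, hc⟩ := h (X v)
  refine ⟨c, LinearMap.ext fun w => ?_⟩
  obtain ⟨a, rfl⟩ := h w
  rw [map_smul, ← hc, smul_comm]
  rfl

theorem hasBlockSum_of_finrank_eq_one (hE : finrank ℂ E = 1) {A P Q : E →ₗ[ℂ] E}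
    (hA : A.IsPositive) (hA' : (1 - A).IsPositive) (hP : P.IsSymmetricProjection)
    (hQ : Q.IsSymmetricProjection) : HasBlockSum A P Q := by
  have : Nontrivial E := Module.nontrivial_of_finrank_pos (R := ℂ) (by omega)
  have idem : ∀ {X : E →ₗ[ℂ] E}, X.IsSymmetricProjection → X = 0 ∨ X = 1 := by
    intro X hX
    obtain ⟨c, rfl⟩ := exists_eq_smul_one hE X
    have h := hX.1.eq
    rw [smul_mul_smul_comm, one_mul] at h
    have : c * c = c := smul_left_injective ℂ (one_ne_zero (α := E →ₗ[ℂ] E)) h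
    have : c * (c - 1) = 0 := by linear_combination this
    rcases mul_eq_zero.mp this with h | h
    · simp [h]
    · simp [sub_eq_zero.mp h]
  have ha := (Complex.nonneg_iff.mp hA.trace_nonneg).1
  have ha' := (Complex.nonneg_iff.mp hA'.trace_nonneg).1
  rw [map_sub, LinearMap.trace_one, hE, Complex.sub_re] at ha'
  norm_num at ha'
  unfold HasBlockSum
  have := fun p q => isBlockSum_one (p := p) (q := q) ha ha'
  rcases idem hP with rfl | rfl <;> rcases idem hQ with rfl | rfl
  · simpa [hE] using this 0 0 (by simp) (by simp)
  · simpa [hE] using this 0 1 (by simp) (by simp)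
  · simpa [hE] using this 1 0 (by simp) (by simp)
  · simpa [hE] using this 1 1 (by simp) (by simp)

end Operators

/-- Every triple consisting of a positive contraction and two projections has the trace data of a
block sum: an eigenvector `v` of `P + Q` spans together with `P v` a common invariant subspace of
`P` and `Q` of dimension at most two, to which one compresses. -/
theorem hasBlockSum {E : Type*} [NormedAddCommGroup E] [InnerProductSpace ℂ E]
    [FiniteDimensional ℂ E] {A P Q : E →ₗ[ℂ] E} (hA : A.IsPositive) (hA' : (1 - A).IsPositive)
    (hP : P.IsSymmetricProjection) (hQ : Q.IsSymmetricProjection) : HasBlockSum A P Q := by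
  induction hn : Module.finrank ℂ E using Nat.strong_induction_on generalizing E with
  | _ n ih =>
  rcases subsingleton_or_nontrivial E with hE | hE
  · have h0 : ∀ X : E →ₗ[ℂ] E, X = 0 := fun X => Subsingleton.elim _ _
    unfold HasBlockSum
    rw [h0 A, h0 P, h0 Q]
    simpa [Module.finrank_zero_of_subsingleton] using isBlockSum_zero
  obtain ⟨μ, hμ⟩ := Module.End.exists_eigenvalue (P + Q)
  obtain ⟨v, hv⟩ := hμ.exists_hasEigenvector
  have hv0 : v ≠ 0 := hv.2
  have hQv : Q v = μ • v - P v := by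
    rw [← hv.apply_eq_smul, LinearMap.add_apply, add_sub_cancel_left]
  have hPP : ∀ x, P (P x) = P x := fun x => LinearMap.congr_fun hP.1.eq x
  have hQQ : ∀ x, Q (Q x) = Q x := fun x => LinearMap.congr_fun hQ.1.eq x
  have step : ∀ W : Submodule ℂ E, v ∈ W → (∀ w ∈ W, P w ∈ W) → (∀ w ∈ W, Q w ∈ W) →
      HasBlockSum (compress W A) (compress W P) (compress W Q) → HasBlockSum A P Q := by
    intro W hvW hPW hQW hW
    refine .of_compress hP.2 hQ.2 hPW hQW hW (ih _ ?_ (hA.compress _) ?_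
      (hP.compress (hP.2.apply_mem_orthogonal hPW))
      (hQ.compress (hQ.2.apply_mem_orthogonal hQW)) rfl)
    · have := W.finrank_add_finrank_orthogonal
      have : 0 < Module.finrank ℂ W :=
        Module.finrank_pos_iff_exists_ne_zero.mpr ⟨⟨v, hvW⟩, by simpa using hv0⟩
      omega
    · rw [compress_one_sub]
      exact hA'.compress _
  have hvs := Submodule.mem_span_singleton_self (R := ℂ) v
  by_cases hPv : P v ∈ ℂ ∙ v
  · have inv : ∀ X : E →ₗ[ℂ] E, X v ∈ ℂ ∙ v → ∀ w ∈ ℂ ∙ v, X w ∈ ℂ ∙ v := by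
      intro X hX w hw
      obtain ⟨c, rfl⟩ := Submodule.mem_span_singleton.mp hw
      rw [map_smul]
      exact Submodule.smul_mem _ c hX
    have hP' := inv P hPv
    have hQ' := inv Q (by rw [hQv]; exact sub_mem (Submodule.smul_mem _ _ hvs) hPv)
    refine step _ hvs hP' hQ' (hasBlockSum_of_finrank_eq_one (finrank_span_singleton hv0)
      (hA.compress _) ?_ (hP.compress hP') (hQ.compress hQ'))
    rw [compress_one_sub]
    exact hA'.compress _
  · have hQv' : Q v ∉ ℂ ∙ v := fun h => hPv <| by
      rw [show P v = μ • v - Q v by rw [hQv, sub_sub_cancel]]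
      exact sub_mem (Submodule.smul_mem _ _ hvs) h
    set W := Submodule.span ℂ {v, P v} with hW
    have hvW : v ∈ W := Submodule.subset_span (by simp)
    have hPvW : P v ∈ W := Submodule.subset_span (by simp)
    have hQvW : Q v ∈ W := by
      rw [hQv]
      exact sub_mem (W.smul_mem _ hvW) hPvW
    have inv : ∀ X : E →ₗ[ℂ] E, X v ∈ W → X (P v) ∈ W → ∀ w ∈ W, X w ∈ W := by
      intro X h1 h2 w hw
      obtain ⟨a, b, rfl⟩ := Submodule.mem_span_pair.mp hw
      rw [map_add, map_smul, map_smul]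
      exact add_mem (W.smul_mem _ h1) (W.smul_mem _ h2)
    have hP' := inv P hPvW (by rw [hPP]; exact hPvW)
    have hQ' := inv Q hQvW (by
      rw [show P v = μ • v - Q v by rw [hQv, sub_sub_cancel], map_sub, map_smul, hQQ]
      exact sub_mem (W.smul_mem _ hQvW) hQvW)
    have hlin : LinearIndependent ℂ ![v, P v] := by
      rw [LinearIndependent.pair_iff' hv0]
      exact fun a ha => hPv (Submodule.mem_span_singleton.mpr ⟨a, ha⟩)
    have hWE : Module.finrank ℂ W = 2 := by
      have := finrank_span_eq_card hlin
      rwa [Matrix.range_cons, Matrix.range_cons, Matrix.range_empty, Set.union_empty,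
        Set.singleton_union] at this
    have htr : ∀ X : E →ₗ[ℂ] E, X.IsSymmetricProjection → (∀ w ∈ W, X w ∈ W) → X v ∉ ℂ ∙ v →
        LinearMap.trace ℂ W (compress W X) = 1 := by
      intro X hX hXW hXv
      refine trace_eq_one_of_apply_notMem_span hWE (hX.compress hXW).1 (v := ⟨v, hvW⟩) fun h => ?_
      obtain ⟨c, hc⟩ := Submodule.mem_span_singleton.mp h
      refine hXv (Submodule.mem_span_singleton.mpr ⟨c, ?_⟩)
      rw [← coe_compress_apply hXW ⟨v, hvW⟩, ← hc]
      rfl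
    refine step W hvW hP' hQ' (hasBlockSum_of_finrank_eq_two hWE (hA.compress _) ?_
      (hP.compress hP') (hQ.compress hQ') (htr P hP hP' hPv) (htr Q hQ hQ' hQv'))
    rw [compress_one_sub]
    exact hA'.compress _

theorem IsProjn.isSymmetricProjection {d : ℕ} {P : Matrix (Fin d) (Fin d) ℂ} (hP : IsProjn P) :
    (Matrix.toLpLinAlgEquiv (R := ℂ) 2 P).IsSymmetricProjection :=
  ⟨by rw [IsIdempotentElem, ← map_mul, hP.2], Matrix.isSymmetric_toEuclideanLin_iff.mpr hP.1⟩

theorem isBlockSum_of_mem_corrSet {d n₁ n₂ n₃ : ℕ} (hd : 0 < d) {v : ℝ × ℝ × ℝ}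
    (hv : v ∈ corrSet d n₁ n₂ n₃) :
    IsBlockSum d n₁ n₂ n₃ (d * v.1) (d * v.2.1) (d * v.2.2) := by
  obtain ⟨P₁, P₂, P₃, h₁, h₂, h₃, rfl, rfl, rfl, rfl⟩ := hv
  have hd' : (d : ℝ) ≠ 0 := by positivity
  have := hasBlockSum h₁.isSymmetricProjection.isPositive
    h₁.isSymmetricProjection.one_sub.isPositive h₂.isSymmetricProjection h₃.isSymmetricProjection
  rw [HasBlockSum, ← map_mul, ← map_mul, ← map_mul] at this
  have htr : ∀ X : Matrix (Fin d) (Fin d) ℂ, LinearMap.trace ℂ (EuclideanSpace ℂ (Fin d))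
      (Matrix.toLpLinAlgEquiv (R := ℂ) 2 X) = X.trace := fun X => by
    rw [← Matrix.trace_toLin'_eq, ← LinearMap.trace_conj' (Matrix.toLin' X)
      (WithLp.linearEquiv 2 ℂ (Fin d → ℂ)).symm]
    rfl
  rw [htr, htr, htr, htr, htr, htr, h₁.trace_eq_rank, h₂.trace_eq_rank, h₃.trace_eq_rank,
    finrank_euclideanSpace_fin] at this
  simpa [mul_inv_cancel_left₀ hd'] using this

/-- The projection onto the qubit state with the given Bloch vector. -/
noncomputable def blochMatrix (r : Fin 3 → ℝ) : Matrix (Fin 2) (Fin 2) ℂ :=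
  !![(1 + r 2) / 2, (r 0 - r 1 * Complex.I) / 2; (r 0 + r 1 * Complex.I) / 2, (1 - r 2) / 2]

theorem isProjn_blochMatrix {r : Fin 3 → ℝ} (hr : r ⬝ᵥ r = 1) : IsProjn (blochMatrix r) := by
  have h : (r 0 : ℂ) * r 0 + r 1 * r 1 + r 2 * r 2 = 1 := by
    rw [dotProduct, Fin.sum_univ_three] at hr
    exact_mod_cast hr
  have hI := Complex.I_mul_I
  constructor
  · ext i j
    fin_cases i <;> fin_cases j <;> simp [blochMatrix, sub_eq_add_neg]
  · ext i j
    fin_cases i <;> fin_cases j <;> simp [blochMatrix, Matrix.mul_apply, Fin.sum_univ_two]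
    · linear_combination (1 / 4) * h - (1 / 4) * r 1 * r 1 * hI
    · ring
    · ring
    · linear_combination (1 / 4) * h - (1 / 4) * r 1 * r 1 * hI

theorem rank_blochMatrix {r : Fin 3 → ℝ} (hr : r ⬝ᵥ r = 1) : (blochMatrix r).rank = 1 := by
  have h := (isProjn_blochMatrix hr).trace_eq_rank
  have : (blochMatrix r).trace = 1 := by
    rw [Matrix.trace_fin_two]
    simp [blochMatrix]
    ring
  rw [this] at h
  exact_mod_cast h.symm

theorem trace_blochMatrix_mul (r s : Fin 3 → ℝ) :
    (blochMatrix r * blochMatrix s).trace.re = (1 + r ⬝ᵥ s) / 2 := by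
  simp [blochMatrix, Matrix.trace_fin_two, dotProduct, Fin.sum_univ_three]
  ring

open scoped MatrixOrder Matrix.Norms.L2Operator in
theorem Matrix.PosSemidef.exists_eq_dotProduct {n : Type*} [Fintype n] [DecidableEq n]
    {M : Matrix n n ℝ} (hM : M.PosSemidef) : ∃ v : n → n → ℝ, ∀ i j, M i j = v i ⬝ᵥ v j := by
  obtain ⟨B, rfl⟩ := CStarAlgebra.nonneg_iff_eq_star_mul_self.mp hM.nonneg
  exact ⟨fun i k => B k i, fun i j => by simp [Matrix.mul_apply, dotProduct, Matrix.star_apply]⟩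

theorem IsBloch.mem_corrSet {x y z : ℝ} (h : IsBloch 1 x y z) :
    (x / 2, y / 2, z / 2) ∈ corrSet 2 1 1 1 := by
  have hM : (!![1, 2 * x - 1, 2 * y - 1; 2 * x - 1, 1, 2 * z - 1; 2 * y - 1, 2 * z - 1, 1] :
      Matrix (Fin 3) (Fin 3) ℝ).PosSemidef := by
    refine Matrix.posSemidef_iff_dotProduct_mulVec.mpr ⟨?_, fun w => ?_⟩
    · ext i j
      fin_cases i <;> fin_cases j <;> simp
    · refine (h (w 0) (w 1) (w 2)).trans_eq ?_
      simp [dotProduct, Matrix.mulVec, Fin.sum_univ_three]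
      ring
  obtain ⟨v, hv⟩ := hM.exists_eq_dotProduct
  have h1 : ∀ i, v i ⬝ᵥ v i = 1 := fun i => by
    rw [← hv]
    fin_cases i <;> simp
  refine ⟨_, _, _, isProjn_blochMatrix (h1 0), isProjn_blochMatrix (h1 1),
    isProjn_blochMatrix (h1 2), rank_blochMatrix (h1 0), rank_blochMatrix (h1 1),
    rank_blochMatrix (h1 2), ?_⟩
  rw [trace_blochMatrix_mul, trace_blochMatrix_mul, trace_blochMatrix_mul, ← hv, ← hv, ← hv]
  simp
  refine ⟨?_, ?_, ?_⟩ <;> ring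

theorem IsBloch.mem_smul_corrSet {u x y z : ℝ} (hu : 0 < u) (h : IsBloch u x y z) :
    (x, y, z) ∈ (2 * u) • corrSet 2 1 1 1 := by
  have h1 : IsBloch 1 (u⁻¹ * x) (u⁻¹ * y) (u⁻¹ * z) := by
    simpa [inv_mul_cancel₀ hu.ne'] using h.smul (inv_nonneg.mpr hu.le)
  refine ⟨_, h1.mem_corrSet, ?_⟩
  ext <;> simp <;> field_simp

/-- Proposition 3.11 (type II slices from above): if `2(n+k) ≤ d`, then
`S_d(n, n+k, n+k) ⊆ co(A₁ ∪ A₂)` where `A₁ = max(0,(6n+4k−2d)/d)·S₂(1)` and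
`A₂ = (2n/d)·S₂(1) + {0}×{0}×[0, k/d]`. -/
theorem corrSet_typeII (n k d : ℕ) (hn : 0 < n) (hk : 0 < k) (hd : 0 < d)
    (h : 2 * (n + k) ≤ d) :
    corrSet d n (n + k) (n + k) ⊆
      convexHull ℝ
        (((max 0 ((6 * (n : ℝ) + 4 * (k : ℝ) - 2 * (d : ℝ)) / (d : ℝ))) •
            corrSet 2 1 1 1) ∪
          (((2 * (n : ℝ)) / (d : ℝ)) • corrSet 2 1 1 1 +
            ({(0 : ℝ)} ×ˢ ({(0 : ℝ)} ×ˢ Set.Icc (0 : ℝ) ((k : ℝ) / (d : ℝ)))))) := by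
  rintro ⟨x, y, z⟩ hv
  have hd' : (0 : ℝ) < d := by positivity
  have hn' : (0 : ℝ) < n := by positivity
  have hB := isBlockSum_of_mem_corrSet hd hv
  simp only [Nat.cast_add] at hB
  obtain ⟨u, e, Z, hB, hz, he, hek, htu, hun, hor⟩ :=
    hB.exists_isBloch (by exact_mod_cast h) k.cast_nonneg
  have hmax : max 0 ((6 * (n : ℝ) + 4 * k - 2 * d) / d) =
      2 / (d : ℝ) * max 0 (3 * (n : ℝ) + 2 * k - d) := by
    rw [mul_max_of_nonneg _ _ (by positivity), mul_zero]
    congr 1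
    ring
  rw [hmax]
  set t : ℝ := max 0 (3 * n + 2 * k - d) with ht
  have ht0 : 0 ≤ t := le_max_left _ _
  have hB' := hB.smul (inv_nonneg.mpr hd'.le)
  rw [inv_mul_cancel_left₀ hd'.ne', inv_mul_cancel_left₀ hd'.ne'] at hB'
  have hz' : z = (d : ℝ)⁻¹ * Z + e / d := by
    field_simp
    linarith
  have hA₂ : ∀ c, 0 ≤ c → c ≤ (k : ℝ) / d →
      ((0 : ℝ), (0 : ℝ), c) ∈ ({(0 : ℝ)} ×ˢ ({(0 : ℝ)} ×ˢ Set.Icc (0 : ℝ) ((k : ℝ) / d))) :=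
    fun c h0 h1 => ⟨rfl, rfl, h0, h1⟩
  rcases hor with rfl | rfl
  · rcases (ht0.trans htu).eq_or_lt with rfl | hu
    · have ht' : t = 0 := le_antisymm htu ht0
      have hone : IsBloch 1 1 1 1 := fun r s t => by
        linear_combination sq_nonneg (r + s + t)
      rw [mul_zero] at hB'
      obtain ⟨hx, hy, hZ⟩ := hB'.eq_zero
      refine subset_convexHull ℝ _ (Or.inl ⟨_, hone.mem_corrSet, ?_⟩)
      simp [hx, hy, hz', hZ, ht', ← Prod.zero_eq_mk]
    · have h1 := (hB'.smul (inv_nonneg.mpr (by positivity : 0 ≤ (d : ℝ)⁻¹ * u)))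
      rw [inv_mul_cancel₀ (by positivity)] at h1
      set s := ((d : ℝ)⁻¹ * u)⁻¹ with hs
      have hseg : u ∈ segment ℝ t (n : ℝ) := by
        rw [segment_eq_Icc (htu.trans hun)]
        exact ⟨htu, hun⟩
      obtain ⟨a, b, ha, hb, hab, rfl⟩ := hseg
      have h₁ := Set.smul_mem_smul_set (a := 2 / (d : ℝ) * t) h1.mem_corrSet
      have h₂ := Set.add_mem_add (Set.smul_mem_smul_set (a := 2 * (n : ℝ) / d) h1.mem_corrSet)
        (hA₂ 0 le_rfl (by positivity))
      refine Set.mem_of_eq_of_mem ?_ (convex_convexHull ℝ _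
        (subset_convexHull ℝ _ (Set.mem_union_left _ h₁))
        (subset_convexHull ℝ _ (Set.mem_union_right _ h₂)) ha hb hab)
      have hval : ∀ w, a * (2 / d * t * (s * w / 2)) + b * (2 * n / d * (s * w / 2)) = w := by
        intro w
        have : ((d : ℝ)⁻¹ * (a • t + b • (n : ℝ))) * s = 1 := mul_inv_cancel₀ (by positivity)
        simp only [smul_eq_mul] at this
        linear_combination w * this
      ext
      · simpa using (hval x).symm
      · simpa using (hval y).symm
      · simpa [hz'] using (hval ((d : ℝ)⁻¹ * Z)).symm
  · refine subset_convexHull ℝ _ (Or.inr ?_)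
    have hmem := hB'.mem_smul_corrSet (by positivity)
    rw [show 2 * ((d : ℝ)⁻¹ * n) = 2 * n / d by ring] at hmem
    refine ⟨_, hmem, _, hA₂ (e / d) (by positivity) (by gcongr), ?_⟩
    simp [hz']
end
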